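/- Let J ⊆ ℝ be an open interval and let c : J → ℂ^n be a continuous curve with c(t) ∈ σ(ℂ^m) for all t ∈ J. Suppose that for every t₀ ∈ J there exist an open neighborhood J_{t₀} ⊆ J of t₀ and a differentiable map c̄_{t₀} : J_{t₀} → ℂ^m with σ ∘ c̄_{t₀} = c on J_{t₀}. Then there exists a differentiable map c̄ : J → ℂ^m with σ ∘ c̄ = c on all of J. (This local-to-global gluing of differentiable lifts, using a fixed group element to match two lifts and their derivatives at a point, is the maximality argument in the proof of the paper's theorem on differentiable lifts.) -/

import Mathlib

open MeasureTheory Set Filter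

open scoped Topology

/-- A curve `u` vanishing frequently near `b` (away from `b`) vanishes at `b` to first order. -/
lemma HasDerivAt.eq_zero_of_frequently_eq_zero {E : Type*} [NormedAddCommGroup E]
    [NormedSpace ℝ E] {u : ℝ → E} {u' : E} {b : ℝ} (hu : HasDerivAt u u' b)
    (h : ∃ᶠ s in 𝓝[≠] b, u s = 0) : u b = 0 ∧ u' = 0 := by
  have h0 : u b = 0 := by
    have := isClosed_singleton.mem_of_frequently_of_tendsto (s := {(0 : E)}) h
      (hu.continuousAt.tendsto.mono_left nhdsWithin_le_nhds)
    simpa using this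
  refine ⟨h0, ?_⟩
  have := isClosed_singleton.mem_of_frequently_of_tendsto (s := {(0 : E)})
    (h.mono fun s hs => (by simp [slope, hs, h0] : slope u b s ∈ ({0} : Set E)))
    (hasDerivAt_iff_tendsto_slope.1 hu)
  simpa using this

/-- If two curves lie pointwise in the same orbit of a finite family of linear maps, then a single
member of the family matches both the values and the derivatives at a given point. -/
lemma HasDerivAt.exists_apply_eq_of_eventually {E G : Type*} [NormedAddCommGroup E]
    [NormedSpace ℝ E] [Finite G] {A : G → E →L[ℝ] E} {f g : ℝ → E} {f' g' : E} {b : ℝ}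
    (hf : HasDerivAt f f' b) (hg : HasDerivAt g g' b)
    (h : ∀ᶠ s in 𝓝 b, ∃ k, A k (f s) = g s) : ∃ k, A k (f b) = g b ∧ A k f' = g' := by
  have hk : ∃ k, ∃ᶠ s in 𝓝[≠] b, A k (f s) = g s := by
    by_contra hcon
    simp only [not_exists, not_frequently] at hcon
    obtain ⟨s, hs, k, hk⟩ :=
      ((eventually_all.2 hcon).and (h.filter_mono nhdsWithin_le_nhds)).exists
    exact hs k hk
  obtain ⟨k, hk⟩ := hk
  have hu : HasDerivAt (fun s => A k (f s) - g s) (A k f' - g') b :=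
    ((A k).hasFDerivAt.comp_hasDerivAt b hf).sub hg
  have := hu.eq_zero_of_frequently_eq_zero (hk.mono fun s hs => sub_eq_zero.2 hs)
  exact ⟨k, sub_eq_zero.1 this.1, sub_eq_zero.1 this.2⟩

/-- `f` is differentiable at `t` and lifts `c` along `p` near `t`. -/
def IsDiffLiftAt {E Y : Type*} [NormedAddCommGroup E] [NormedSpace ℝ E] (p : E → Y) (c : ℝ → Y)
    (f : ℝ → E) (t : ℝ) : Prop :=
  DifferentiableAt ℝ f t ∧ ∀ᶠ s in 𝓝 t, p (f s) = c s

namespace IsDiffLiftAt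

variable {E Y G : Type*} [NormedAddCommGroup E] [NormedSpace ℝ E] {p : E → Y} {c : ℝ → Y}

lemma congr {f g : ℝ → E} {t : ℝ} (hf : IsDiffLiftAt p c f t) (h : g =ᶠ[𝓝 t] f) :
    IsDiffLiftAt p c g t := by
  refine ⟨hf.1.congr_of_eventuallyEq h, ?_⟩
  filter_upwards [hf.2, h] with s hs hs'
  rw [hs', hs]

lemma clm_comp {A : E →L[ℝ] E} (hA : ∀ x, p (A x) = p x) {f : ℝ → E} {t : ℝ}
    (hf : IsDiffLiftAt p c f t) : IsDiffLiftAt p c (fun s => A (f s)) t :=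
  ⟨A.differentiableAt.comp t hf.1, hf.2.mono fun s hs => by rw [hA, hs]⟩

/-- Two lifts agreeing to first order at `b` can be concatenated at `b`. -/
lemma ite_le {f g : ℝ → E} {b : ℝ} (hf : IsDiffLiftAt p c f b) (hg : IsDiffLiftAt p c g b)
    (h0 : f b = g b) (h1 : deriv f b = deriv g b) {t : ℝ}
    (hl : t ≤ b → IsDiffLiftAt p c f t) (hr : b ≤ t → IsDiffLiftAt p c g t) :
    IsDiffLiftAt p c (fun s => if s ≤ b then f s else g s) t := by
  rcases lt_trichotomy t b with h | rfl | h
  · refine (hl h.le).congr ?_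
    filter_upwards [Iio_mem_nhds h] with s hs
    exact if_pos (le_of_lt hs)
  · constructor
    · have hL : HasDerivWithinAt (fun s => if s ≤ t then f s else g s) (deriv f t) (Iic t) t :=
        hf.1.hasDerivAt.hasDerivWithinAt.congr (fun s hs => if_pos hs) (if_pos le_rfl)
      have hR : HasDerivWithinAt (fun s => if s ≤ t then f s else g s) (deriv f t) (Ici t) t := by
        rw [h1]
        refine hg.1.hasDerivAt.hasDerivWithinAt.congr (fun s hs => ?_) (by simp [h0])
        rcases eq_or_lt_of_le (mem_Ici.1 hs) with rfl | hs
        · simp [h0]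
        · exact if_neg (not_le.2 hs)
      have := hL.union hR
      rw [Iic_union_Ici, hasDerivWithinAt_univ] at this
      exact this.differentiableAt
    · filter_upwards [hf.2, hg.2] with s hs hs'
      split_ifs
      · exact hs
      · exact hs'
  · refine (hr h.le).congr ?_
    filter_upwards [Ioi_mem_nhds h] with s hs
    exact if_neg (not_le.2 hs)

variable [Finite G] {A : G → E →L[ℝ] E}

/-- A lift can be moved by an element of the family to agree with another one to first order. -/
lemma exists_matching (hA : ∀ k x, p (A k x) = p x)
    (hsep : ∀ x y, p x = p y → ∃ k, A k x = y) {f g : ℝ → E} {b : ℝ}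
    (hf : IsDiffLiftAt p c f b) (hg : IsDiffLiftAt p c g b) :
    ∃ g' : ℝ → E, (∀ t, IsDiffLiftAt p c g t → IsDiffLiftAt p c g' t) ∧ g' b = f b ∧
      deriv g' b = deriv f b := by
  obtain ⟨k, h0, h1⟩ := hg.1.hasDerivAt.exists_apply_eq_of_eventually (A := A) hf.1.hasDerivAt (by
    filter_upwards [hf.2, hg.2] with s hs hs'
    exact hsep _ _ (hs'.trans hs.symm))
  refine ⟨fun s => A k (g s), fun t ht => ht.clm_comp (hA k), h0, ?_⟩
  rw [← h1]
  exact ((A k).hasFDerivAt.comp_hasDerivAt b hg.1.hasDerivAt).deriv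

lemma exists_extend_right (hA : ∀ k x, p (A k x) = p x)
    (hsep : ∀ x y, p x = p y → ∃ k, A k x = y) {f g : ℝ → E} {b : ℝ}
    (hf : IsDiffLiftAt p c f b) (hg : IsDiffLiftAt p c g b) :
    ∃ h : ℝ → E, EqOn h f (Iic b) ∧ ∀ t, (t ≤ b → IsDiffLiftAt p c f t) →
      (b ≤ t → IsDiffLiftAt p c g t) → IsDiffLiftAt p c h t := by
  obtain ⟨g', hg', h0, h1⟩ := exists_matching hA hsep hf hg
  exact ⟨fun s => if s ≤ b then f s else g' s, fun s hs => if_pos hs, fun t hl hr =>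
    hf.ite_le (hg' b hg) h0.symm h1.symm hl fun h => hg' t (hr h)⟩

lemma exists_extend_left (hA : ∀ k x, p (A k x) = p x)
    (hsep : ∀ x y, p x = p y → ∃ k, A k x = y) {f g : ℝ → E} {a : ℝ}
    (hf : IsDiffLiftAt p c f a) (hg : IsDiffLiftAt p c g a) :
    ∃ h : ℝ → E, EqOn h f (Ici a) ∧ ∀ t, (a ≤ t → IsDiffLiftAt p c f t) →
      (t ≤ a → IsDiffLiftAt p c g t) → IsDiffLiftAt p c h t := by
  obtain ⟨g', hg', h0, h1⟩ := exists_matching hA hsep hf hg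
  refine ⟨fun s => if s ≤ a then g' s else f s, fun s hs => ?_, fun t hr hl =>
    (hg' a hg).ite_le hf h0 h1 (fun h => hg' t (hl h)) hr⟩
  rcases eq_or_lt_of_le (mem_Ici.1 hs) with rfl | hs
  · simp [h0]
  · exact if_neg (not_le.2 hs)

/-- Local lifts glue to a lift on every compact subinterval. -/
lemma exists_on_Icc (hA : ∀ k x, p (A k x) = p x)
    (hsep : ∀ x y, p x = p y → ∃ k, A k x = y) {J : Set ℝ} (hJc : J.OrdConnected)
    (hloc : ∀ t ∈ J, ∃ f : ℝ → E, ∀ᶠ s in 𝓝 t, IsDiffLiftAt p c f s) {a b : ℝ}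
    (ha : a ∈ J) (hb : b ∈ J) : ∃ f : ℝ → E, ∀ t ∈ Icc a b, IsDiffLiftAt p c f t := by
  refine hJc.isPreconnected.induction₂'
    (fun a b => ∃ f : ℝ → E, ∀ t ∈ Icc a b, IsDiffLiftAt p c f t) ?_ ?_ ha hb
  · intro x hx
    obtain ⟨f, hf⟩ := hloc x hx
    obtain ⟨ε, hε, hball⟩ := Metric.eventually_nhds_iff_ball.1 hf
    have hconn : (Metric.ball x ε).OrdConnected := (convex_ball x ε).ordConnected
    filter_upwards [nhdsWithin_le_nhds (Metric.ball_mem_nhds x hε)] with y hy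
    have hxx := Metric.mem_ball_self (x := x) hε
    exact ⟨⟨f, fun t ht => hball t (hconn.out hxx hy ht)⟩,
      ⟨f, fun t ht => hball t (hconn.out hy hxx ht)⟩⟩
  · rintro x y z - - - ⟨f, hf⟩ ⟨g, hg⟩
    rcases lt_or_ge y x with hyx | hxy
    · exact ⟨g, fun t ht => hg t ⟨hyx.le.trans ht.1, ht.2⟩⟩
    rcases lt_or_ge z y with hzy | hyz
    · exact ⟨f, fun t ht => hf t ⟨ht.1, ht.2.trans hzy.le⟩⟩
    obtain ⟨h, -, hh⟩ := exists_extend_right hA hsep (hf y ⟨hxy, le_rfl⟩) (hg y ⟨le_rfl, hyz⟩)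
    exact ⟨h, fun t ht => hh t (fun h => hf t ⟨ht.1, h⟩) fun h => hg t ⟨h, ht.2⟩⟩

/-- A lift on a compact subinterval extends to any larger compact subinterval. -/
lemma exists_extend_Icc (hA : ∀ k x, p (A k x) = p x)
    (hsep : ∀ x y, p x = p y → ∃ k, A k x = y) {J : Set ℝ} (hJc : J.OrdConnected)
    (hloc : ∀ t ∈ J, ∃ f : ℝ → E, ∀ᶠ s in 𝓝 t, IsDiffLiftAt p c f s) {a b a' b' : ℝ}
    (hab : a ≤ b) (ha : a' ≤ a) (hb : b ≤ b') (ha' : a' ∈ J) (hb' : b' ∈ J) {f : ℝ → E}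
    (hf : ∀ t ∈ Icc a b, IsDiffLiftAt p c f t) :
    ∃ h : ℝ → E, EqOn h f (Icc a b) ∧ ∀ t ∈ Icc a' b', IsDiffLiftAt p c h t := by
  obtain ⟨g, hg⟩ := exists_on_Icc hA hsep hJc hloc ha' hb'
  obtain ⟨h₁, he₁, hh₁⟩ := exists_extend_left hA hsep (hf a ⟨le_rfl, hab⟩)
    (hg a ⟨ha, hab.trans hb⟩)
  have hlift₁ : ∀ t ∈ Icc a' b, IsDiffLiftAt p c h₁ t := fun t ht =>
    hh₁ t (fun h => hf t ⟨h, ht.2⟩) fun _ => hg t ⟨ht.1, ht.2.trans hb⟩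
  obtain ⟨h₂, he₂, hh₂⟩ := exists_extend_right hA hsep (hlift₁ b ⟨ha.trans hab, le_rfl⟩)
    (hg b ⟨ha.trans hab, hb⟩)
  exact ⟨h₂, fun t ht => (he₂ ht.2).trans (he₁ ht.1), fun t ht =>
    hh₂ t (fun h => hlift₁ t ⟨ht.1, h⟩) fun _ => hg t ht⟩

/-- Local lifts glue to a global lift on an open interval. -/
lemma exists_global (hA : ∀ k x, p (A k x) = p x)
    (hsep : ∀ x y, p x = p y → ∃ k, A k x = y) {J : Set ℝ} (hJo : IsOpen J)
    (hJc : J.OrdConnected)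
    (hloc : ∀ t ∈ J, ∃ f : ℝ → E, ∀ᶠ s in 𝓝 t, IsDiffLiftAt p c f s) :
    ∃ f : ℝ → E, ∀ t ∈ J, IsDiffLiftAt p c f t := by
  rcases J.eq_empty_or_nonempty with rfl | ⟨t₀, ht₀⟩
  · exact ⟨0, by simp⟩
  let S := {s : ℝ × ℝ × (ℝ → E) // s.1 ≤ s.2.1 ∧ s.1 ∈ J ∧ s.2.1 ∈ J ∧
    ∀ t ∈ Icc s.1 s.2.1, IsDiffLiftAt p c s.2.2 t}
  have step : ∀ (q : ℝ) (s : S), ∃ s' : S, Icc s.1.1 s.1.2.1 ⊆ Icc s'.1.1 s'.1.2.1 ∧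
      EqOn s'.1.2.2 s.1.2.2 (Icc s.1.1 s.1.2.1) ∧ (q ∈ J → q ∈ Icc s'.1.1 s'.1.2.1) := by
    rintro q ⟨⟨a, b, f⟩, hab, ha, hb, hf⟩
    by_cases hq : q ∈ J
    · have ha' : min a q ∈ J := by rcases min_choice a q with h | h <;> rw [h] <;> assumption
      have hb' : max b q ∈ J := by rcases max_choice b q with h | h <;> rw [h] <;> assumption
      obtain ⟨h, he, hh⟩ := exists_extend_Icc hA hsep hJc hloc hab (min_le_left a q)
        (le_max_left b q) ha' hb' hf
      exact ⟨⟨⟨min a q, max b q, h⟩, (min_le_left a q).trans (hab.trans (le_max_left b q)),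
        ha', hb', hh⟩, Icc_subset_Icc (min_le_left a q) (le_max_left b q), he,
        fun _ => ⟨min_le_right a q, le_max_right b q⟩⟩
    · exact ⟨⟨⟨a, b, f⟩, hab, ha, hb, hf⟩, Subset.rfl, fun _ _ => rfl, fun h => absurd h hq⟩
  choose succ hsub heq hmem using step
  obtain ⟨f₀, hf₀⟩ := exists_on_Icc hA hsep hJc hloc ht₀ ht₀
  let s : ℕ → S := fun n => Nat.rec ⟨⟨t₀, t₀, f₀⟩, le_rfl, ht₀, ht₀, hf₀⟩
    (fun k s => succ (TopologicalSpace.denseSeq ℝ k) s) n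
  let I : ℕ → Set ℝ := fun n => Icc (s n).1.1 (s n).1.2.1
  have hI : Monotone I := monotone_nat_of_le_succ fun n => hsub _ (s n)
  have hF : ∀ n k, n ≤ k → EqOn (s k).1.2.2 (s n).1.2.2 (I n) := by
    intro n k hnk
    induction k, hnk using Nat.le_induction with
    | base => exact fun _ _ => rfl
    | succ k hk ih => exact fun t ht => (heq _ (s k) (hI hk ht)).trans (ih ht)
  have hcov : ∀ V : Set ℝ, IsOpen V → V.Nonempty → V ⊆ J → ∃ n, ∃ q ∈ V, q ∈ I n := by
    intro V hV hne hVJ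
    obtain ⟨k, hk⟩ := (TopologicalSpace.denseRange_denseSeq ℝ).exists_mem_open hV hne
    exact ⟨k + 1, _, hk, hmem _ (s k) (hVJ hk)⟩
  have hint : ∀ t ∈ J, ∃ n, I n ∈ 𝓝 t := by
    intro t ht
    obtain ⟨ε, hε, hball⟩ := Metric.isOpen_iff.1 hJo t ht
    rw [Real.ball_eq_Ioo] at hball
    obtain ⟨n, q, hq, hqn⟩ := hcov (Ioo (t - ε) t) isOpen_Ioo (nonempty_Ioo.2 (by linarith))
      ((Ioo_subset_Ioo_right (by linarith)).trans hball)
    obtain ⟨k, r, hr, hrk⟩ := hcov (Ioo t (t + ε)) isOpen_Ioo (nonempty_Ioo.2 (by linarith))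
      ((Ioo_subset_Ioo_left (by linarith)).trans hball)
    have hq' : q ∈ I (max n k) := hI (le_max_left n k) hqn
    have hr' : r ∈ I (max n k) := hI (le_max_right n k) hrk
    exact ⟨max n k, Icc_mem_nhds (hq'.1.trans_lt hq.2) (hr.1.trans_le hr'.2)⟩
  classical
  let F : ℝ → E := fun t => if h : ∃ n, t ∈ I n then (s h.choose).1.2.2 t else 0
  have hFn : ∀ n, EqOn F (s n).1.2.2 (I n) := by
    intro n t ht
    have h : ∃ n, t ∈ I n := ⟨n, ht⟩
    have hFt : F t = (s h.choose).1.2.2 t := dif_pos h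
    rw [hFt]
    rcases le_total n h.choose with hle | hle
    · exact hF _ _ hle ht
    · exact (hF _ _ hle h.choose_spec).symm
  refine ⟨F, fun t ht => ?_⟩
  obtain ⟨n, hn⟩ := hint t ht
  exact ((s n).2.2.2.2 t (mem_of_mem_nhds hn)).congr ((hFn n).eventuallyEq_of_mem hn)

end IsDiffLiftAt

/-- Invariant polynomials of a finite linear group separate orbits. -/
lemma MvPolynomial.exists_apply_eq_of_forall_invariant_eval_eq {K ι G : Type*} [Field K]
    [Fintype ι] [Group G] [Fintype G] (ρ : G →* ((ι → K) ≃ₗ[K] (ι → K)))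
    {x y : ι → K}
    (h : ∀ f : MvPolynomial ι K, (∀ g z, MvPolynomial.eval (ρ g z) f = MvPolynomial.eval z f) →
      MvPolynomial.eval x f = MvPolynomial.eval y f) : ∃ g, ρ g x = y := by
  classical
  by_contra! hne
  have hcoord : ∀ g, ∃ i, ρ g x i ≠ y i := fun g => Function.ne_iff.1 (hne g)
  choose i hi using hcoord
  -- `P` vanishes at `y` and equals one on the orbit of `x`
  let P : MvPolynomial ι K :=
    1 - ∏ g, (1 - C (ρ g x (i g) - y (i g))⁻¹ * (X (i g) - C (y (i g))))
  have hPy : eval y P = 0 := by simp [P]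
  have hPx : ∀ g, eval (ρ g x) P = 1 := by
    intro g
    simp only [P, map_sub, map_one, map_prod, map_mul, eval_C, eval_X, sub_eq_self]
    exact Finset.prod_eq_zero (Finset.mem_univ g)
      (by rw [inv_mul_cancel₀ (sub_ne_zero.2 (hi g)), sub_self])
  let L : G → ι → MvPolynomial ι K := fun g j => ∑ l, C (ρ g (Pi.single l 1) j) * X l
  have hL : ∀ g z, (fun j => eval z (L g j)) = ρ g z := by
    intro g z
    ext j
    conv_rhs => rw [pi_eq_sum_univ' z]
    simp only [L, map_sum, map_mul, eval_C, eval_X, map_smul, Finset.sum_apply, Pi.smul_apply,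
      smul_eq_mul]
    exact Finset.sum_congr rfl fun l _ => by rw [mul_comm]
  let F : MvPolynomial ι K := ∏ g, bind₁ (L g) P
  have hF : ∀ z, eval z F = ∏ g, eval (ρ g z) P := by
    intro z
    simp only [F, map_prod]
    refine Finset.prod_congr rfl fun g _ => ?_
    rw [← hL g z]
    exact eval₂Hom_bind₁ _ _ _ _
  have key := h F fun g z => by
    rw [hF, hF]
    exact Fintype.prod_equiv (Equiv.mulRight g) _ _ fun k => by simp [map_mul]
  rw [hF, hF, Finset.prod_congr rfl fun g _ => hPx g, Finset.prod_const_one,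
    Finset.prod_eq_zero (Finset.mem_univ 1) (by simpa using hPy)] at key
  exact one_ne_zero key

/-- Local-to-global gluing of differentiable lifts (finite group): if a continuous
curve in `σ(ℂ^m)` admits differentiable lifts locally near each point of an open
interval `J`, then it admits a differentiable lift on all of `J`. -/
theorem stmt16
    {m n : ℕ} {G : Type} [Group G] [Fintype G]
    (ρ : G →* ((Fin m → ℂ) ≃ₗ[ℂ] (Fin m → ℂ)))
    (σ : Fin n → MvPolynomial (Fin m) ℂ) (deg : Fin n → ℕ)
    (hdeg : ∀ k, 1 ≤ deg k)
    (hhom : ∀ k, (σ k).IsHomogeneous (deg k))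
    (hinv : ∀ k g x, MvPolynomial.eval (ρ g x) (σ k) = MvPolynomial.eval x (σ k))
    (hgen : ∀ f : MvPolynomial (Fin m) ℂ,
      (∀ g x, MvPolynomial.eval (ρ g x) f = MvPolynomial.eval x f) →
      ∃ p : MvPolynomial (Fin n) ℂ, MvPolynomial.aeval σ p = f)
    (σm : (Fin m → ℂ) → (Fin n → ℂ))
    (hσm : ∀ x k, σm x k = MvPolynomial.eval x (σ k))
    (J : Set ℝ) (hJo : IsOpen J) (hJc : J.OrdConnected)
    (c : ℝ → Fin n → ℂ) (hc : ContinuousOn c J)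
    (hcσ : ∀ t ∈ J, ∃ x : Fin m → ℂ, σm x = c t)
    (hloc : ∀ t₀ ∈ J, ∃ (Jt : Set ℝ) (cb : ℝ → Fin m → ℂ), IsOpen Jt ∧ t₀ ∈ Jt ∧ Jt ⊆ J ∧
      ∀ t ∈ Jt, DifferentiableAt ℝ cb t ∧ σm (cb t) = c t) :
    ∃ cb : ℝ → Fin m → ℂ, ∀ t ∈ J, DifferentiableAt ℝ cb t ∧ σm (cb t) = c t := by
  let A : G → (Fin m → ℂ) →L[ℝ] (Fin m → ℂ) := fun g =>
    (LinearMap.toContinuousLinearMap (ρ g).toLinearMap).restrictScalars ℝ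
  have hA : ∀ k x, σm (A k x) = σm x := fun k x => by
    ext j
    rw [hσm, hσm]
    exact hinv j k x
  have hsep : ∀ x y, σm x = σm y → ∃ k, A k x = y := fun x y hxy =>
    MvPolynomial.exists_apply_eq_of_forall_invariant_eval_eq ρ fun f hf => by
      obtain ⟨p, rfl⟩ := hgen f hf
      have heval : ∀ z, MvPolynomial.eval z (MvPolynomial.aeval σ p) =
          MvPolynomial.eval (σm z) p := fun z => by
        rw [funext (hσm z)]
        exact MvPolynomial.eval₂Hom_bind₁ _ _ _ _
      rw [heval, heval, hxy]
  obtain ⟨f, hf⟩ := IsDiffLiftAt.exists_global (c := c) hA hsep hJo hJc fun t ht => by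
    obtain ⟨Jt, cb, hopen, htJ, -, hcb⟩ := hloc t ht
    refine ⟨cb, ?_⟩
    filter_upwards [hopen.mem_nhds htJ] with s hs
    refine ⟨(hcb s hs).1, ?_⟩
    filter_upwards [hopen.mem_nhds hs] with r hr using (hcb r hr).2
  exact ⟨f, fun t ht => ⟨(hf t ht).1, (hf t ht).2.self_of_nhds⟩⟩
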